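/- Let w(n) be a stable sequence with limiting partition (S_1,…,S_r). For each j ∈ {1,…,r} write Q_j = S_1 ∪ … ∪ S_{j−1} (so Q_1 = ∅) and define normalized vectors v^{(j)}(n) by v^{(j)}(n)_i = C_i^{Q_j}·w(n)_i / Σ_{i′∈S_j} C_{i′}^{Q_j}·w(n)_{i′} for i ∈ S_j. Then: (a) for each j, v^{(j)}(n) converges as n → ∞ to a vector v^{(j)} with v^{(j)}_i > 0 for all i ∈ S_j; and (b) the matrices f(λ, w(n)) converge entrywise as n → ∞, and the limit is the block-diagonal d×d matrix whose j-th diagonal block (of size |S_j|, occupying rows and columns Σ_{k<j}|S_k|+1, …, Σ_{k≤j}|S_k|) is f(λ|_{S_j}, v^{(j)}|_{S_j}). -/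

import Mathlib

noncomputable section
open Polynomial Filter Topology ENNReal

/-- The inner product `⟨p,q⟩_v = ∑ₖ p(μₖ)q(μₖ)vₖ`. -/
def ip {m : ℕ} (μ v : Fin m → ℝ) (p q : ℝ[X]) : ℝ :=
  ∑ k, p.eval (μ k) * q.eval (μ k) * v k

/-- Pair `(pₙ, pₙ₋₁)` of monic orthogonal polynomials (with `p₋₁ = 0`). -/
def opAux {m : ℕ} (μ v : Fin m → ℝ) : ℕ → ℝ[X] × ℝ[X]
  | 0 => (1, 0)
  | n + 1 =>
    let P := opAux μ v n
    ((X - C (ip μ v P.1 (X * P.1) / ip μ v P.1 P.1)) * P.1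
        - C (ip μ v P.1 P.1 / ip μ v P.2 P.2) * P.2, P.1)

/-- The `n`-th monic orthogonal polynomial of the recursion. -/
def op {m : ℕ} (μ v : Fin m → ℝ) (n : ℕ) : ℝ[X] := (opAux μ v n).1

/-- The entry `a_N` of the Jacobi matrix construction: for odd `N = 2n+1` the diagonal
entry `a_{2n+1} = ⟨pₙ, Xpₙ⟩/⟨pₙ,pₙ⟩`, for even `N = 2n` the off-diagonal entry
`a_{2n} = √(⟨pₙ,pₙ⟩/⟨pₙ₋₁,pₙ₋₁⟩)`. -/
def fEnt {m : ℕ} (μ v : Fin m → ℝ) (N : ℕ) : ℝ :=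
  if N % 2 = 1 then
    ip μ v (op μ v (N / 2)) (X * op μ v (N / 2)) / ip μ v (op μ v (N / 2)) (op μ v (N / 2))
  else
    Real.sqrt (ip μ v (op μ v (N / 2)) (op μ v (N / 2)) /
      ip μ v (op μ v (N / 2 - 1)) (op μ v (N / 2 - 1)))

/-- The symmetric tridiagonal matrix `f(μ, v)` with diagonal `a₁,a₃,…` and
sub/super-diagonal `a₂,a₄,…`. -/
def Jmat {m : ℕ} (μ v : Fin m → ℝ) : Matrix (Fin m) (Fin m) ℝ :=
  Matrix.of fun i j =>
    if i = j then fEnt μ v (2 * (i : ℕ) + 1)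
    else if (i : ℕ) + 1 = (j : ℕ) ∨ (j : ℕ) + 1 = (i : ℕ) then fEnt μ v ((i : ℕ) + (j : ℕ) + 1)
    else 0

/-- Restriction of `g : Fin d → ℝ` to a subset `Q`, reindexed in increasing order. -/
def restr {d : ℕ} (Q : Finset (Fin d)) (g : Fin d → ℝ) : Fin Q.card → ℝ :=
  fun k => g ((Q.orderIsoOfFin rfl) k).1

/-- Leading `i × i` principal submatrix. -/
def leadSub {d : ℕ} (J : Matrix (Fin d) (Fin d) ℝ) (i : ℕ) (h : i ≤ d) :
    Matrix (Fin i) (Fin i) ℝ :=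
  Matrix.of fun a b => J ⟨a.1, lt_of_lt_of_le a.2 h⟩ ⟨b.1, lt_of_lt_of_le b.2 h⟩

/-- A sequence of positive weight vectors is stable if all pairwise ratios converge
in `[0,∞]`. -/
def Stable {d : ℕ} (w : ℕ → Fin d → ℝ) : Prop :=
  (∀ n i, 0 < w n i) ∧
    ∀ i j : Fin d, ∃ L : ℝ≥0∞,
      Tendsto (fun n => ENNReal.ofReal (w n i / w n j)) atTop (𝓝 L)

/-- `S : Fin r → Finset (Fin d)` is an ordered partition of `{0,…,d-1}`. -/
def OrdPart {d r : ℕ} (S : Fin r → Finset (Fin d)) : Prop :=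
  (∀ j, (S j).Nonempty) ∧ (∀ j k, j ≠ k → Disjoint (S j) (S k)) ∧
    Finset.univ.biUnion S = (Finset.univ : Finset (Fin d))

/-- `S` is the limiting partition of the stable sequence `w`. -/
def LimPart {d r : ℕ} (w : ℕ → Fin d → ℝ) (S : Fin r → Finset (Fin d)) : Prop :=
  OrdPart S ∧
  (∀ i j : Fin d, (∃ a, i ∈ S a ∧ j ∈ S a) ↔
      ∃ L : ℝ, 0 < L ∧ Tendsto (fun n => w n i / w n j) atTop (𝓝 L)) ∧
  (∀ a b : Fin r, a < b → ∀ i ∈ S a, ∀ j ∈ S b,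
      Tendsto (fun n => w n i / w n j) atTop atTop)

/-- The constant `C_i^T = ∏_{t ∈ T} (λ_t − λ_i)²`. -/
def Cc {d : ℕ} (lam : Fin d → ℝ) (i : Fin d) (T : Finset (Fin d)) : ℝ :=
  ∏ t ∈ T, (lam t - lam i) ^ 2

/-- Offset `∑_{k<j} |S_k|` of the `j`-th block. -/
def offS {d r : ℕ} (S : Fin r → Finset (Fin d)) (j : Fin r) : ℕ :=
  ∑ k ∈ Finset.univ.filter (· < j), (S k).card

/-- The block-diagonal matrix whose `j`-th block (in rows/columns
`offS S j, …, offS S j + |S_j| - 1`) is `Jmat (restr (S j) lam) (restr (S j) (v j))`. -/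
def blockDiag {d r : ℕ} (lam : Fin d → ℝ) (S : Fin r → Finset (Fin d))
    (v : Fin r → Fin d → ℝ) : Matrix (Fin d) (Fin d) ℝ :=
  Matrix.of fun p q =>
    ∑ j : Fin r,
      if h : offS S j ≤ (p : ℕ) ∧ (p : ℕ) < offS S j + (S j).card ∧
          offS S j ≤ (q : ℕ) ∧ (q : ℕ) < offS S j + (S j).card then
        Jmat (restr (S j) lam) (restr (S j) (v j))
          ⟨(p : ℕ) - offS S j, by omega⟩ ⟨(q : ℕ) - offS S j, by omega⟩
      else 0

/-- Nonempty subsets of `Fin d`. -/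
abbrev NES (d : ℕ) := {S : Finset (Fin d) // S.Nonempty}

/-- The ambient Euclidean space of families `(w^S)` indexed by nonempty subsets. -/
abbrev Ew (d : ℕ) := NES d → Fin d → ℝ

/-- The blow-up `B` (normalized representatives): support, nonnegativity,
normalization, and the quadratic equations. -/
def Bset {d : ℕ} (lam : Fin d → ℝ) : Set (Ew d) :=
  {w | (∀ S : NES d, ∀ n, n ∉ S.1 → w S n = 0) ∧
    (∀ S n, 0 ≤ w S n) ∧
    (∀ S : NES d, ∑ n ∈ S.1, w S n = 1) ∧
    ∀ R S : NES d, R.1 ⊆ S.1 → ∀ i ∈ R.1, ∀ j ∈ R.1,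
      Cc lam i (S.1 \ R.1) * w R j * w S i = Cc lam j (S.1 \ R.1) * w R i * w S j}

/-- `𝒥̄^Λ`: symmetric tridiagonal matrices with nonnegative off-diagonal entries and
characteristic polynomial `∏ (X − λ_k)`. -/
def Jset {d : ℕ} (lam : Fin d → ℝ) : Set (Matrix (Fin d) (Fin d) ℝ) :=
  {J | (∀ i j, J i j = J j i) ∧
    (∀ i j : Fin d, (i : ℕ) + 2 ≤ (j : ℕ) ∨ (j : ℕ) + 2 ≤ (i : ℕ) → J i j = 0) ∧
    (∀ i j : Fin d, (i : ℕ) + 1 = (j : ℕ) → 0 ≤ J i j) ∧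
    J.charpoly = ∏ k, (X - C (lam k))}

/-- `K_j = S_j ∪ S_{j+1} ∪ … ∪ S_r`. -/
def Kof {d r : ℕ} (S : Fin r → Finset (Fin d)) (j : Fin r) : Finset (Fin d) :=
  (Finset.univ.filter (j ≤ ·)).biUnion S

/-- The piece `Z(P)` of `B` corresponding to the ordered partition `P = (S_1,…,S_r)`:
for every nonempty `T`, the support of `w^T` is `T ∩ S_{i(T,P)}`. -/
def Zset {d : ℕ} (lam : Fin d → ℝ) {r : ℕ} (S : Fin r → Finset (Fin d)) : Set (Ew d) :=
  {w | w ∈ Bset lam ∧ ∀ T : NES d, ∃ j : Fin r, T.1 ⊆ Kof S j ∧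
    (∀ k, T.1 ⊆ Kof S k → k ≤ j) ∧ ∀ n : Fin d, w T n ≠ 0 ↔ n ∈ T.1 ∧ n ∈ S j}

/-- `R ⪯ S`: the ordered partition `R` refines `S`, i.e. `R` is the concatenation of
ordered partitions of `S_1`, then `S_2`, etc. -/
def Refines {d q r : ℕ} (R : Fin q → Finset (Fin d)) (S : Fin r → Finset (Fin d)) : Prop :=
  ∃ b : Fin (r + 1) → ℕ, b 0 = 0 ∧ b (Fin.last r) = q ∧
    (∀ i j : Fin (r + 1), i ≤ j → b i ≤ b j) ∧
    ∀ i : Fin r, S i = (Finset.univ.filter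
      (fun k : Fin q => b i.castSucc ≤ (k : ℕ) ∧ (k : ℕ) < b i.succ)).biUnion R

/-- The `j`-th consecutive interval `I_j(T)` of lengths `|T_1|,…,|T_r|`. -/
def Iint {d r : ℕ} (T : Fin r → Finset (Fin d)) (j : Fin r) : Finset (Fin d) :=
  Finset.univ.filter (fun m : Fin d => offS T j ≤ (m : ℕ) ∧ (m : ℕ) < offS T j + (T j).card)

/-- `H(T) = {σ : σ(T_j) = I_j(T) for all j}`. -/
def Hset {d r : ℕ} (T : Fin r → Finset (Fin d)) : Set (Equiv.Perm (Fin d)) :=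
  {σ | ∀ j, (T j).image σ = Iint T j}

/-- Interval Young subgroups: setwise stabilizers of a division of `{0,…,d-1}` into
consecutive intervals. -/
def IsIntervalYoung {d : ℕ} (G : Set (Equiv.Perm (Fin d))) : Prop :=
  ∃ (q : ℕ) (c : Fin q → Finset (Fin d)), OrdPart c ∧ (∀ j : Fin q, c j = Iint c j) ∧
    G = {τ : Equiv.Perm (Fin d) | ∀ j, (c j).image ⇑τ = c j}

/-- Number of surjections from an `a`-element set onto a `b`-element set. -/
def Surj (a b : ℕ) : ℕ := Fintype.card {f : Fin a → Fin b // Function.Surjective f}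

/-- The Euler characteristic `χ_d = ∑_{q=1}^d (−2)^{d−q}·Surj(d,q)`. -/
def chi (a : ℕ) : ℝ := ∑ q ∈ Finset.Icc 1 a, (-2 : ℝ) ^ (a - q) * (Surj a q : ℝ)

section OrthogonalPolynomials

variable {m : ℕ} (μ v : Fin m → ℝ)

lemma ip_comm (p q : ℝ[X]) : ip μ v p q = ip μ v q p := by
  unfold ip
  exact Finset.sum_congr rfl fun k _ => by ring

lemma ip_add_right (p q r : ℝ[X]) : ip μ v p (q + r) = ip μ v p q + ip μ v p r := by
  simp only [ip, ← Finset.sum_add_distrib, eval_add]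
  exact Finset.sum_congr rfl fun k _ => by ring

lemma ip_sub_right (p q r : ℝ[X]) : ip μ v p (q - r) = ip μ v p q - ip μ v p r := by
  simp only [ip, ← Finset.sum_sub_distrib, eval_sub]
  exact Finset.sum_congr rfl fun k _ => by ring

lemma ip_C_mul_right (c : ℝ) (p q : ℝ[X]) : ip μ v p (C c * q) = c * ip μ v p q := by
  simp only [ip, Finset.mul_sum, eval_mul, eval_C]
  exact Finset.sum_congr rfl fun k _ => by ring

lemma ip_X_mul_comm (p q : ℝ[X]) : ip μ v p (X * q) = ip μ v (X * p) q := by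
  simp only [ip, eval_mul, eval_X]
  exact Finset.sum_congr rfl fun k _ => by ring

lemma ip_zero_right (p : ℝ[X]) : ip μ v p 0 = 0 := by simp [ip]

/-- The predecessor `pₙ₋₁` of `pₙ`, equal to `0` for `n = 0`. -/
def opPrev (n : ℕ) : ℝ[X] := (opAux μ v n).2

@[simp] lemma op_zero : op μ v 0 = 1 := rfl

@[simp] lemma opPrev_zero : opPrev μ v 0 = 0 := rfl

@[simp] lemma opPrev_succ (n : ℕ) : opPrev μ v (n + 1) = op μ v n := rfl

/-- The diagonal recursion coefficient `a_{2n+1}`. -/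
def diagCoeff (n : ℕ) : ℝ :=
  ip μ v (op μ v n) (X * op μ v n) / ip μ v (op μ v n) (op μ v n)

/-- The squared off-diagonal recursion coefficient `a_{2n}²`. -/
def offCoeff (n : ℕ) : ℝ :=
  ip μ v (op μ v n) (op μ v n) / ip μ v (opPrev μ v n) (opPrev μ v n)

lemma op_succ (n : ℕ) : op μ v (n + 1) =
    (X - C (diagCoeff μ v n)) * op μ v n - C (offCoeff μ v n) * opPrev μ v n := rfl

lemma fEnt_odd (n : ℕ) : fEnt μ v (2 * n + 1) = diagCoeff μ v n := by
  have h : (2 * n + 1) / 2 = n := by omega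
  simp [fEnt, diagCoeff, h, Nat.add_mod]

lemma fEnt_even (n : ℕ) : fEnt μ v (2 * n + 2) = √(offCoeff μ v (n + 1)) := by
  have h : (2 * n + 2) / 2 = n + 1 := by omega
  simp [fEnt, offCoeff, h]

lemma op_monic_degree (n : ℕ) :
    (op μ v n).Monic ∧ (op μ v n).natDegree = n ∧ (opPrev μ v n).degree < n := by
  induction n with
  | zero => simp
  | succ n ih =>
    obtain ⟨hm, hd, hp⟩ := ih
    have hdeg : (op μ v n).degree = n := by rw [degree_eq_natDegree hm.ne_zero, hd]
    have hm1 : ((X - C (diagCoeff μ v n)) * op μ v n).Monic := (monic_X_sub_C _).mul hm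
    have hd1 : ((X - C (diagCoeff μ v n)) * op μ v n).natDegree = n + 1 := by
      rw [(monic_X_sub_C _).natDegree_mul hm, natDegree_X_sub_C, hd, add_comm]
    have hlt : (C (offCoeff μ v n) * opPrev μ v n).degree <
        ((X - C (diagCoeff μ v n)) * op μ v n).degree := by
      rw [degree_eq_natDegree hm1.ne_zero, hd1]
      rw [C_mul']
      refine lt_of_le_of_lt (degree_smul_le _ _) (hp.trans ?_)
      exact_mod_cast Nat.lt_succ_self n
    refine ⟨?_, ?_, ?_⟩
    · rw [op_succ]; exact hm1.sub_of_left hlt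
    · rw [op_succ, natDegree_sub_eq_left_of_natDegree_lt, hd1]
      rw [hd1]
      refine lt_of_le_of_lt (natDegree_C_mul_le _ _) ?_
      by_cases h0 : opPrev μ v n = 0
      · simp [h0]
      · exact ((natDegree_lt_iff_degree_lt h0).2 hp).trans (Nat.lt_succ_self n)
    · rw [opPrev_succ, hdeg]; exact_mod_cast Nat.lt_succ_self n

lemma op_monic (n : ℕ) : (op μ v n).Monic := (op_monic_degree μ v n).1

lemma op_natDegree (n : ℕ) : (op μ v n).natDegree = n := (op_monic_degree μ v n).2.1

lemma op_degree (n : ℕ) : (op μ v n).degree = n := by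
  rw [degree_eq_natDegree (op_monic μ v n).ne_zero, op_natDegree]

variable {μ v}

lemma ip_self_pos (hμ : Function.Injective μ) (hv : ∀ k, 0 < v k) {p : ℝ[X]} (hp : p ≠ 0)
    (hd : p.degree < m) : 0 < ip μ v p p := by
  have hex : ∃ k, p.eval (μ k) ≠ 0 := by
    by_contra! h
    refine hp (eq_zero_of_degree_lt_of_eval_index_eq_zero Finset.univ hμ.injOn ?_
      fun i _ => h i)
    simpa using hd
  obtain ⟨k, hk⟩ := hex
  refine Finset.sum_pos' (fun i _ => ?_) ⟨k, Finset.mem_univ _, ?_⟩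
  · exact mul_nonneg (mul_self_nonneg _) (hv i).le
  · exact mul_pos (mul_self_pos.2 hk) (hv k)

lemma ip_op_pos (hμ : Function.Injective μ) (hv : ∀ k, 0 < v k) {n : ℕ} (hn : n < m) :
    0 < ip μ v (op μ v n) (op μ v n) :=
  ip_self_pos hμ hv (op_monic μ v n).ne_zero (by rw [op_degree]; exact_mod_cast hn)

lemma ip_op_op (hμ : Function.Injective μ) (hv : ∀ k, 0 < v k) {n : ℕ} (hn : n ≤ m) :
    ∀ i < n, ip μ v (op μ v i) (op μ v n) = 0 := by
  induction n using Nat.strong_induction_on with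
  | _ n ih =>
    intro i hi
    obtain ⟨n, rfl⟩ : ∃ k, n = k + 1 := ⟨n - 1, by omega⟩
    have hX : ∀ i, X * op μ v i = op μ v (i + 1) + C (diagCoeff μ v i) * op μ v i
        + C (offCoeff μ v i) * opPrev μ v i := fun i => by rw [op_succ]; ring
    have ihn := ih n (Nat.lt_succ_self n) (by omega)
    have hNn := (ip_op_pos hμ hv (show n < m by omega)).ne'
    rw [op_succ, sub_mul, ip_sub_right, ip_sub_right, ip_C_mul_right, ip_C_mul_right]
    rcases eq_or_lt_of_le (Nat.lt_succ_iff.1 hi) with rfl | hin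
    · have h0 : ip μ v (op μ v i) (opPrev μ v i) = 0 := by
        cases i with
        | zero => simp [ip_zero_right]
        | succ i => rw [opPrev_succ, ip_comm]; exact ihn i (Nat.lt_succ_self i)
      rw [h0, diagCoeff, div_mul_cancel₀ _ hNn]; simp
    · obtain ⟨n, rfl⟩ : ∃ k, n = k + 1 := ⟨n - 1, by omega⟩
      rw [ihn i hin, ip_X_mul_comm, hX, ip_comm, ip_add_right, ip_add_right, ip_C_mul_right,
        ip_C_mul_right, ip_comm _ _ _ (op μ v i), ihn i hin, opPrev_succ]
      have h0 : ip μ v (op μ v (n + 1)) (opPrev μ v i) = 0 := by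
        cases i with
        | zero => simp [ip_zero_right]
        | succ i => rw [opPrev_succ, ip_comm]; exact ihn i (by omega)
      rw [h0]
      rcases eq_or_lt_of_le (Nat.lt_succ_iff.1 hin) with rfl | hin'
      · rw [offCoeff.eq_1 μ v (i + 1), opPrev_succ,
          div_mul_cancel₀ _ (ip_op_pos hμ hv (show i < m by omega)).ne']
        ring
      · rw [ip_comm, ihn (i + 1) (by omega), ih n (by omega) (by omega) i hin']
        ring

lemma ip_op_eq_zero_of_degree_lt (hμ : Function.Injective μ) (hv : ∀ k, 0 < v k) {n : ℕ}
    (hn : n ≤ m) {q : ℝ[X]} (hq : q.degree < n) : ip μ v q (op μ v n) = 0 := by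
  suffices H : ∀ k ≤ n, ∀ q : ℝ[X], q.degree < k → ip μ v (op μ v n) q = 0 by
    rw [ip_comm]; exact H n le_rfl q hq
  intro k
  induction k with
  | zero =>
    intro _ q hq
    rw [show q = 0 by simpa using hq, ip_zero_right]
  | succ k ih =>
    intro hk q hq
    have h1 : q.degree ≤ k := Order.lt_succ_iff.1 hq
    have h2 : (q - C (q.coeff k) * op μ v k).degree < k := by
      rw [degree_lt_iff_coeff_zero]
      intro j hj
      rcases eq_or_lt_of_le hj with rfl | hj
      · have := (op_monic μ v k).coeff_natDegree
        rw [op_natDegree] at this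
        simp [this]
      · have e1 : q.coeff j = 0 := coeff_eq_zero_of_degree_lt (h1.trans_lt (by exact_mod_cast hj))
        have e2 : (op μ v k).coeff j = 0 :=
          coeff_eq_zero_of_natDegree_lt (by rw [op_natDegree]; exact hj)
        simp [e1, e2]
    have h3 := ih (by omega) _ h2
    rw [ip_sub_right, ip_C_mul_right, ip_comm _ _ _ (op μ v k), ip_op_op hμ hv hn k (by omega)] at h3
    simpa using h3

lemma ip_basis {A : Finset (Fin m)} {k : Fin m} (hμ : Function.Injective μ) (hk : k ∈ A)
    (p : ℝ[X]) : ip μ v (Lagrange.basis A μ k) p =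
      p.eval (μ k) * v k + ∑ i ∈ Aᶜ, (Lagrange.basis A μ k).eval (μ i) * p.eval (μ i) * v i := by
  unfold ip
  rw [← Finset.sum_add_sum_compl A, Finset.sum_eq_single_of_mem k hk,
    Lagrange.eval_basis_self hμ.injOn hk, one_mul]
  intro i hi hik
  rw [Lagrange.eval_basis_of_ne (Ne.symm hik) hi]
  simp

lemma op_eval_mul_weight (hμ : Function.Injective μ) (hv : ∀ k, 0 < v k) {A : Finset (Fin m)}
    {k : Fin m} (hk : k ∈ A) {n : ℕ} (hn : n ≤ m) (hA : A.card ≤ n) :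
    (op μ v n).eval (μ k) * v k =
      -∑ i ∈ Aᶜ, (Lagrange.basis A μ k).eval (μ i) * (op μ v n).eval (μ i) * v i := by
  have hpos : 0 < A.card := Finset.card_pos.2 ⟨k, hk⟩
  have h := ip_op_eq_zero_of_degree_lt hμ hv hn (q := Lagrange.basis A μ k) (by
    rw [Lagrange.degree_basis hμ.injOn hk]
    exact_mod_cast (by omega : A.card - 1 < n))
  rw [ip_basis hμ hk] at h
  linarith

lemma op_full (hμ : Function.Injective μ) (hv : ∀ k, 0 < v k) :
    op μ v m = ∏ k, (X - C (μ k)) := by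
  have hM : (∏ k, (X - C (μ k))).Monic := monic_prod_of_monic _ _ fun k _ => monic_X_sub_C _
  have hdeg : (∏ k, (X - C (μ k))).natDegree = m := by
    rw [natDegree_prod_of_monic _ _ fun k _ => monic_X_sub_C _]; simp
  refine eq_of_degree_sub_lt_of_eval_index_eq Finset.univ hμ.injOn ?_ fun k _ => ?_
  · have := degree_sub_lt_left (p := op μ v m) (q := ∏ k, (X - C (μ k)))
      (by rw [op_degree, degree_eq_natDegree hM.ne_zero, hdeg])
      (op_monic μ v m).ne_zero (by rw [(op_monic μ v m).leadingCoeff, hM.leadingCoeff])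
    rw [op_degree] at this
    simpa using this
  · have h := op_eval_mul_weight hμ hv (Finset.mem_univ k) le_rfl (by simp)
    rw [Finset.compl_univ, Finset.sum_empty, neg_zero] at h
    rw [(mul_eq_zero.1 h).resolve_right (hv k).ne', eval_prod]
    exact (Finset.prod_eq_zero (Finset.mem_univ k) (by simp)).symm

end OrthogonalPolynomials

section Block

variable {d : ℕ}

lemma sum_restr (B : Finset (Fin d)) (g : Fin d → ℝ) :
    ∑ k : Fin B.card, g ((B.orderIsoOfFin rfl) k).1 = ∑ i ∈ B, g i :=
  (Equiv.sum_comp (B.orderIsoOfFin rfl).toEquiv fun x => g x.1).trans (Finset.sum_coe_sort B g)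

lemma prod_restr (B : Finset (Fin d)) (g : Fin d → ℝ) :
    ∏ k : Fin B.card, g ((B.orderIsoOfFin rfl) k).1 = ∏ i ∈ B, g i :=
  (Equiv.prod_comp (B.orderIsoOfFin rfl).toEquiv fun x => g x.1).trans (Finset.prod_coe_sort B g)

lemma ip_restr (B : Finset (Fin d)) (lam v : Fin d → ℝ) (p q : ℝ[X]) :
    ip (restr B lam) (restr B v) p q = ∑ i ∈ B, p.eval (lam i) * q.eval (lam i) * v i :=
  sum_restr B fun i => p.eval (lam i) * q.eval (lam i) * v i

lemma restr_injective {B : Finset (Fin d)} {lam : Fin d → ℝ} (h : Function.Injective lam) :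
    Function.Injective (restr B lam) := fun _ _ hab =>
  (B.orderIsoOfFin rfl).injective (Subtype.ext (h hab))

lemma restr_pos {B : Finset (Fin d)} {v : Fin d → ℝ} (h : ∀ i ∈ B, 0 < v i) (k : Fin B.card) :
    0 < restr B v k := h _ ((B.orderIsoOfFin rfl) k).2

/-- The weights of the points in `A` dominate the scale `W`, those of the points in `B` are
comparable to it with (renormalized) limits `v`, and all the others are negligible. -/
structure BlockScale (lam : Fin d → ℝ) (w : ℕ → Fin d → ℝ) (A B : Finset (Fin d))
    (W : ℕ → ℝ) (v : Fin d → ℝ) : Prop where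
  inj : Function.Injective lam
  disj : Disjoint A B
  weight_pos : ∀ n i, 0 < w n i
  scale_pos : ∀ n, 0 < W n
  lim_pos : ∀ i ∈ B, 0 < v i
  before : ∀ i ∈ A, Tendsto (fun n => W n / w n i) atTop (𝓝 0)
  within : ∀ i ∈ B, Tendsto (fun n => Cc lam i A * w n i / W n) atTop (𝓝 (v i))
  after : ∀ i, i ∉ A → i ∉ B → Tendsto (fun n => w n i / W n) atTop (𝓝 0)

/-- The polynomial `∏_{t ∈ A} (x - λ_t)`. -/
def nodeProd (lam : Fin d → ℝ) (A : Finset (Fin d)) (x : ℝ) : ℝ := ∏ t ∈ A, (x - lam t)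

/-- The asymptotic data with which the recursion enters the block following `A`. -/
structure BlockStart (lam : Fin d → ℝ) (w : ℕ → Fin d → ℝ) (A : Finset (Fin d))
    (W : ℕ → ℝ) : Prop where
  op_lim : ∀ x, Tendsto (fun n => (op lam (w n) A.card).eval x) atTop (𝓝 (nodeProd lam A x))
  prev_lim : ∀ x, ∃ c, Tendsto (fun n => (opPrev lam (w n) A.card).eval x) atTop (𝓝 c)
  scale_lim : Tendsto (fun n => W n /
    ip lam (w n) (opPrev lam (w n) A.card) (opPrev lam (w n) A.card)) atTop (𝓝 0)

lemma nodeProd_sq (lam : Fin d → ℝ) (A : Finset (Fin d)) (i : Fin d) :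
    nodeProd lam A (lam i) ^ 2 = Cc lam i A := by
  rw [nodeProd, Cc, ← Finset.prod_pow]
  exact Finset.prod_congr rfl fun t _ => by ring

lemma Cc_pos {lam : Fin d → ℝ} (h : Function.Injective lam) {A : Finset (Fin d)} {i : Fin d}
    (hi : i ∉ A) : 0 < Cc lam i A := by
  refine Finset.prod_pos fun t ht => sq_pos_of_ne_zero (sub_ne_zero.2 fun e => hi ?_)
  exact h e ▸ ht

namespace BlockScale

variable {lam : Fin d → ℝ} {w : ℕ → Fin d → ℝ} {A B : Finset (Fin d)} {W : ℕ → ℝ} {v : Fin d → ℝ}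

lemma within' (h : BlockScale lam w A B W v) {i : Fin d} (hi : i ∈ B) :
    Tendsto (fun n => w n i / W n) atTop (𝓝 (v i / Cc lam i A)) := by
  have hC := (Cc_pos h.inj (Finset.disjoint_right.1 h.disj hi)).ne'
  refine ((h.within i hi).div_const (Cc lam i A)).congr fun n => ?_
  field_simp

lemma exists_lim (h : BlockScale lam w A B W v) {i : Fin d} (hi : i ∉ A) :
    ∃ c, Tendsto (fun n => w n i / W n) atTop (𝓝 c) := by
  by_cases hB : i ∈ B
  · exact ⟨_, h.within' hB⟩
  · exact ⟨_, h.after i hi hB⟩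

lemma card_le (h : BlockScale lam w A B W v) : A.card + B.card ≤ d := by
  rw [← Finset.card_union_of_disjoint h.disj]
  exact (Finset.card_le_univ _).trans (by simp)

/-- The quadratic functional of the `m`-th orthogonal polynomial, on the scale of the block,
only sees the points of the block in the limit. -/
lemma tendsto_quad (h : BlockScale lam w A B W v) {m : ℕ} (hA : A.card ≤ m) (hm : m ≤ d)
    {q : ℝ → ℝ} (hq : ∀ x, Tendsto (fun n => (op lam (w n) m).eval x) atTop
      (𝓝 (nodeProd lam A x * q x))) (g : ℝ → ℝ) :
    Tendsto (fun n => (∑ k, g (lam k) * (op lam (w n) m).eval (lam k) ^ 2 * w n k) / W n) atTop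
      (𝓝 (∑ i ∈ B, g (lam i) * q (lam i) ^ 2 * v i)) := by
  classical
  have hsum : ∑ i ∈ B, g (lam i) * q (lam i) ^ 2 * v i =
      ∑ i, if i ∈ B then g (lam i) * q (lam i) ^ 2 * v i else 0 := by
    rw [Finset.sum_ite_mem, Finset.univ_inter]
  rw [hsum]
  simp only [Finset.sum_div]
  refine tendsto_finsetSum _ fun k _ => ?_
  by_cases hkA : k ∈ A
  · rw [if_neg (Finset.disjoint_left.1 h.disj hkA)]
    have hlim : ∃ c, Tendsto (fun n => (op lam (w n) m).eval (lam k) * w n k / W n) atTop (𝓝 c) := by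
      have hi : ∀ i, ∃ c, i ∈ Aᶜ → Tendsto (fun n => w n i / W n) atTop (𝓝 c) := fun i => by
        by_cases hi : i ∈ A
        · exact ⟨0, fun h' => absurd hi (Finset.mem_compl.1 h')⟩
        · exact (h.exists_lim hi).imp fun c hc _ => hc
      choose c hc using hi
      refine ⟨-∑ i ∈ Aᶜ, (Lagrange.basis A lam k).eval (lam i) *
        (nodeProd lam A (lam i) * q (lam i)) * c i, ?_⟩
      refine (tendsto_finsetSum Aᶜ fun i hi => (((hq (lam i)).const_mul
        ((Lagrange.basis A lam k).eval (lam i))).mul (hc i hi))).neg.congr fun n => ?_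
      rw [op_eval_mul_weight h.inj (h.weight_pos n) hkA hm hA, neg_div, Finset.sum_div]
      simp only [mul_div_assoc]
    obtain ⟨c, hc⟩ := hlim
    have := ((hc.pow 2).mul (h.before k hkA)).const_mul (g (lam k))
    rw [mul_zero, mul_zero] at this
    refine this.congr fun n => ?_
    have h1 := (h.weight_pos n k).ne'
    have h2 := (h.scale_pos n).ne'
    field_simp
  · by_cases hkB : k ∈ B
    · rw [if_pos hkB]
      have hC := (Cc_pos h.inj hkA).ne'
      have := (((hq (lam k)).pow 2).const_mul (g (lam k))).mul (h.within' hkB)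
      rw [mul_pow, nodeProd_sq] at this
      convert this using 2
      · ring
      · field_simp
    · rw [if_neg hkB]
      have := (((hq (lam k)).pow 2).const_mul (g (lam k))).mul (h.after k hkA hkB)
      rw [mul_zero] at this
      exact this.congr fun n => by ring

lemma tendsto_norm (h : BlockScale lam w A B W v) {l : ℕ} (hl : l ≤ B.card)
    (hq : ∀ x, Tendsto (fun n => (op lam (w n) (A.card + l)).eval x) atTop
      (𝓝 (nodeProd lam A x * (op (restr B lam) (restr B v) l).eval x))) :
    Tendsto (fun n => ip lam (w n) (op lam (w n) (A.card + l)) (op lam (w n) (A.card + l)) / W n)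
      atTop (𝓝 (ip (restr B lam) (restr B v) (op (restr B lam) (restr B v) l)
        (op (restr B lam) (restr B v) l))) := by
  have := h.tendsto_quad (by omega) (by have := h.card_le; omega) hq fun _ => 1
  simp only [one_mul, sq] at this
  rw [ip_restr]
  exact this

lemma norm_restr_pos (h : BlockScale lam w A B W v) {l : ℕ} (hl : l < B.card) :
    0 < ip (restr B lam) (restr B v) (op (restr B lam) (restr B v) l)
        (op (restr B lam) (restr B v) l) :=
  ip_op_pos (restr_injective h.inj) (restr_pos h.lim_pos) hl

lemma tendsto_diagCoeff (h : BlockScale lam w A B W v) {l : ℕ} (hl : l < B.card)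
    (hq : ∀ x, Tendsto (fun n => (op lam (w n) (A.card + l)).eval x) atTop
      (𝓝 (nodeProd lam A x * (op (restr B lam) (restr B v) l).eval x))) :
    Tendsto (fun n => diagCoeff lam (w n) (A.card + l)) atTop
      (𝓝 (diagCoeff (restr B lam) (restr B v) l)) := by
  have h1 := h.tendsto_norm hl.le hq
  have h2 := h.tendsto_quad (by omega) (by have := h.card_le; omega) hq id
  have h3 := h2.div h1 (h.norm_restr_pos hl).ne'
  rw [diagCoeff, ip_restr _ _ _ _ (X * _)]
  convert h3 using 2 with n
  · simp only [Pi.div_apply, diagCoeff]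
    rw [div_div_div_cancel_right₀ (h.scale_pos n).ne']
    congr 1
    refine Finset.sum_congr rfl fun k _ => ?_
    simp only [eval_mul, eval_X, id]
    ring
  · congr 1
    refine Finset.sum_congr rfl fun k _ => ?_
    simp only [eval_mul, eval_X, id]
    ring

lemma tendsto_offCoeff_succ (h : BlockScale lam w A B W v) {l : ℕ} (hl : l + 1 ≤ B.card)
    (hq : ∀ x, Tendsto (fun n => (op lam (w n) (A.card + l)).eval x) atTop
      (𝓝 (nodeProd lam A x * (op (restr B lam) (restr B v) l).eval x)))
    (hq' : ∀ x, Tendsto (fun n => (op lam (w n) (A.card + (l + 1))).eval x) atTop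
      (𝓝 (nodeProd lam A x * (op (restr B lam) (restr B v) (l + 1)).eval x))) :
    Tendsto (fun n => offCoeff lam (w n) (A.card + (l + 1))) atTop
      (𝓝 (offCoeff (restr B lam) (restr B v) (l + 1))) := by
  have h1 := h.tendsto_norm (by omega) hq
  have h2 := h.tendsto_norm hl hq'
  refine (h2.div h1 (h.norm_restr_pos hl).ne').congr fun n => ?_
  simp only [Pi.div_apply]
  rw [div_div_div_cancel_right₀ (h.scale_pos n).ne']
  rfl

lemma tendsto_offCoeff_start (h : BlockScale lam w A B W v) (hs : BlockStart lam w A W) :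
    Tendsto (fun n => offCoeff lam (w n) A.card) atTop (𝓝 0) := by
  have h1 := (h.tendsto_norm (l := 0) (Nat.zero_le _) (by simpa using hs.op_lim)).mul hs.scale_lim
  rw [mul_zero] at h1
  refine h1.congr fun n => ?_
  rw [add_zero, div_mul_div_cancel₀ (h.scale_pos n).ne']
  rfl

lemma tendsto_op_aux (h : BlockScale lam w A B W v) (hs : BlockStart lam w A W) (l : ℕ)
    (hl : l ≤ B.card) (x : ℝ) :
    Tendsto (fun n => (op lam (w n) (A.card + l)).eval x) atTop
      (𝓝 (nodeProd lam A x * (op (restr B lam) (restr B v) l).eval x)) ∧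
    Tendsto (fun n => offCoeff lam (w n) (A.card + l) * (opPrev lam (w n) (A.card + l)).eval x)
      atTop (𝓝 (nodeProd lam A x * (offCoeff (restr B lam) (restr B v) l *
        (opPrev (restr B lam) (restr B v) l).eval x))) := by
  induction l generalizing x with
  | zero =>
    refine ⟨by simpa using hs.op_lim x, ?_⟩
    obtain ⟨c, hc⟩ := hs.prev_lim x
    simpa using (h.tendsto_offCoeff_start hs).mul hc
  | succ l ih =>
    have hq := fun x => (ih (by omega) x).1
    have hq' : ∀ x, Tendsto (fun n => (op lam (w n) (A.card + (l + 1))).eval x) atTop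
        (𝓝 (nodeProd lam A x * (op (restr B lam) (restr B v) (l + 1)).eval x)) := fun x => by
      have h1 := (((h.tendsto_diagCoeff hl hq).const_sub x).mul (hq x)).sub (ih (by omega) x).2
      simp only [← add_assoc, op_succ, eval_sub, eval_mul, eval_X, eval_C]
      convert h1 using 2
      ring
    refine ⟨hq' x, ?_⟩
    have h2 := (h.tendsto_offCoeff_succ hl hq hq').mul (hq x)
    rw [opPrev_succ, mul_left_comm]
    exact h2

lemma tendsto_op (h : BlockScale lam w A B W v) (hs : BlockStart lam w A W) {l : ℕ}
    (hl : l ≤ B.card) (x : ℝ) :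
    Tendsto (fun n => (op lam (w n) (A.card + l)).eval x) atTop
      (𝓝 (nodeProd lam A x * (op (restr B lam) (restr B v) l).eval x)) :=
  (h.tendsto_op_aux hs l hl x).1

lemma tendsto_fEnt_odd (h : BlockScale lam w A B W v) (hs : BlockStart lam w A W) {l : ℕ}
    (hl : l < B.card) : Tendsto (fun n => fEnt lam (w n) (2 * (A.card + l) + 1)) atTop
      (𝓝 (fEnt (restr B lam) (restr B v) (2 * l + 1))) := by
  simp only [fEnt_odd]
  exact h.tendsto_diagCoeff hl (h.tendsto_op hs hl.le)

lemma tendsto_fEnt_even (h : BlockScale lam w A B W v) (hs : BlockStart lam w A W) {l : ℕ}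
    (hl : l + 1 < B.card) : Tendsto (fun n => fEnt lam (w n) (2 * (A.card + l) + 2)) atTop
      (𝓝 (fEnt (restr B lam) (restr B v) (2 * l + 2))) := by
  simp only [fEnt_even]
  exact (h.tendsto_offCoeff_succ hl.le (h.tendsto_op hs (by omega)) (h.tendsto_op hs hl.le)).sqrt

lemma tendsto_fEnt_start (h : BlockScale lam w A B W v) (hs : BlockStart lam w A W) {m : ℕ}
    (hm : m + 1 = A.card) : Tendsto (fun n => fEnt lam (w n) (2 * m + 2)) atTop (𝓝 0) := by
  simp only [fEnt_even, hm]
  simpa using (h.tendsto_offCoeff_start hs).sqrt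

lemma blockStart_next (h : BlockScale lam w A B W v) (hs : BlockStart lam w A W)
    (hB : B.Nonempty) {W' : ℕ → ℝ} (hW : Tendsto (fun n => W' n / W n) atTop (𝓝 0)) :
    BlockStart lam w (A ∪ B) W' := by
  obtain ⟨l, hl⟩ : ∃ l, B.card = l + 1 := ⟨B.card - 1, by have := hB.card_pos; omega⟩
  have hcard : (A ∪ B).card = A.card + B.card := Finset.card_union_of_disjoint h.disj
  have hprev := fun x => h.tendsto_op hs (l := l) (by omega) x
  refine ⟨fun x => ?_, fun x => ?_, ?_⟩
  · have h1 := h.tendsto_op hs le_rfl x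
    rw [op_full (restr_injective h.inj) (restr_pos h.lim_pos), eval_prod] at h1
    simp only [eval_sub, eval_X, eval_C] at h1
    rw [hcard, nodeProd, Finset.prod_union h.disj, ← prod_restr B fun t => x - lam t]
    exact h1
  · rw [hcard, hl]
    exact ⟨_, hprev x⟩
  · rw [hcard, hl]
    have h1 := hW.div (h.tendsto_norm (by omega) hprev) (h.norm_restr_pos (by omega)).ne'
    rw [zero_div] at h1
    refine h1.congr fun n => ?_
    simp only [Pi.div_apply]
    rw [div_div_div_cancel_right₀ (h.scale_pos n).ne']
    rfl

end BlockScale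

lemma blockStart_empty (lam : Fin d → ℝ) (w : ℕ → Fin d → ℝ) (W : ℕ → ℝ) :
    BlockStart lam w ∅ W where
  op_lim x := by simp [nodeProd]
  prev_lim x := ⟨0, by simp⟩
  scale_lim := by simp [ip_zero_right]

end Block

section Partition

variable {d r : ℕ} {S : Fin r → Finset (Fin d)}

lemma offS_eq_card (hS : OrdPart S) (j : Fin r) :
    offS S j = ((Finset.univ.filter (· < j)).biUnion S).card :=
  (Finset.card_biUnion fun a _ b _ hab => hS.2.1 a b hab).symm

lemma offS_add_card_le (S : Fin r → Finset (Fin d)) {j k : Fin r} (h : j < k) :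
    offS S j + (S j).card ≤ offS S k := by
  have hj : j ∉ Finset.univ.filter (· < j) := by simp
  rw [offS, add_comm, ← Finset.sum_insert (f := fun k => (S k).card) hj]
  refine Finset.sum_le_sum_of_subset fun i hi => ?_
  simp only [Finset.mem_insert, Finset.mem_filter, Finset.mem_univ, true_and] at hi ⊢
  rcases hi with rfl | hi
  · exact h
  · exact hi.trans h

lemma eq_of_mem_block {j k : Fin r} {p : ℕ} (hj : offS S j ≤ p ∧ p < offS S j + (S j).card)
    (hk : offS S k ≤ p ∧ p < offS S k + (S k).card) : j = k := by
  rcases lt_trichotomy j k with h | h | h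
  · have := offS_add_card_le S h; omega
  · exact h
  · have := offS_add_card_le S h; omega

lemma exists_block_of_lt_sum (S : Fin r → Finset (Fin d)) (k p : ℕ)
    (hp : p < ∑ i ∈ Finset.univ.filter (fun i : Fin r => (i : ℕ) < k), (S i).card) :
    ∃ j, offS S j ≤ p ∧ p < offS S j + (S j).card := by
  induction k with
  | zero => simp at hp
  | succ k ih =>
    by_cases hk : k < r
    · have hins : Finset.univ.filter (fun i : Fin r => (i : ℕ) < k + 1) =
          insert ⟨k, hk⟩ (Finset.univ.filter (· < (⟨k, hk⟩ : Fin r))) := by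
        ext i
        simp only [Finset.mem_filter, Finset.mem_univ, true_and, Finset.mem_insert, Fin.ext_iff,
          Fin.lt_def]
        omega
      rw [hins, Finset.sum_insert (by simp)] at hp
      change p < _ + offS S ⟨k, hk⟩ at hp
      by_cases h : p < offS S ⟨k, hk⟩
      · exact ih h
      · exact ⟨⟨k, hk⟩, by omega, by omega⟩
    · refine ih (hp.trans_eq (Finset.sum_congr (Finset.filter_congr fun i _ => ?_) fun _ _ => rfl))
      have := i.2
      omega

lemma exists_block (hS : OrdPart S) (p : Fin d) :
    ∃ j, offS S j ≤ (p : ℕ) ∧ (p : ℕ) < offS S j + (S j).card := by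
  refine exists_block_of_lt_sum S r p ?_
  have hsum : ∑ i, (S i).card = d := by
    rw [← Finset.card_biUnion fun a _ b _ hab => hS.2.1 a b hab, hS.2.2, Finset.card_univ,
      Fintype.card_fin]
  rw [Finset.filter_true_of_mem fun i _ => i.2, hsum]
  exact p.2

lemma Jmat_comm {m : ℕ} (μ v : Fin m → ℝ) (i j : Fin m) : Jmat μ v i j = Jmat μ v j i := by
  simp only [Jmat, Matrix.of_apply, eq_comm (a := i), or_comm (a := (i : ℕ) + 1 = j),
    add_comm (i : ℕ) j]
  split_ifs with h
  · rw [h]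
  · rfl
  · rfl

lemma Jmat_diag {m : ℕ} (μ v : Fin m → ℝ) (i : Fin m) :
    Jmat μ v i i = fEnt μ v (2 * (i : ℕ) + 1) := by
  simp [Jmat]

lemma Jmat_succ {m : ℕ} (μ v : Fin m → ℝ) {i j : Fin m} (h : (j : ℕ) = i + 1) :
    Jmat μ v i j = fEnt μ v (2 * (i : ℕ) + 2) := by
  have hij : i ≠ j := fun e => by rw [e] at h; omega
  simp only [Jmat, Matrix.of_apply, if_neg hij, h, true_or, if_true]
  congr 1
  ring

lemma Jmat_far {m : ℕ} (μ v : Fin m → ℝ) {i j : Fin m} (h : (i : ℕ) + 1 < j) :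
    Jmat μ v i j = 0 := by
  have hij : i ≠ j := fun e => by rw [e] at h; omega
  simp only [Jmat, Matrix.of_apply, if_neg hij]
  exact if_neg (by omega)

lemma blockDiag_apply (lam : Fin d → ℝ) (v : Fin r → Fin d → ℝ) {j : Fin r} {p : Fin d}
    (hp : offS S j ≤ (p : ℕ) ∧ (p : ℕ) < offS S j + (S j).card) (q : Fin d) :
    blockDiag lam S v p q =
      if h : offS S j ≤ (q : ℕ) ∧ (q : ℕ) < offS S j + (S j).card then
        Jmat (restr (S j) lam) (restr (S j) (v j))
          ⟨(p : ℕ) - offS S j, by omega⟩ ⟨(q : ℕ) - offS S j, by omega⟩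
      else 0 := by
  rw [blockDiag, Matrix.of_apply, Finset.sum_eq_single j]
  · by_cases h : offS S j ≤ (q : ℕ) ∧ (q : ℕ) < offS S j + (S j).card
    · rw [dif_pos h, dif_pos ⟨hp.1, hp.2, h⟩]
    · rw [dif_neg h, dif_neg fun h' => h h'.2.2]
  · exact fun k _ hk => dif_neg fun h => hk (eq_of_mem_block ⟨h.1, h.2.1⟩ hp)
  · simp

lemma blockDiag_comm (lam : Fin d → ℝ) (v : Fin r → Fin d → ℝ) (p q : Fin d) :
    blockDiag lam S v p q = blockDiag lam S v q p := by
  simp only [blockDiag, Matrix.of_apply]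
  refine Finset.sum_congr rfl fun j _ => ?_
  split_ifs with h1 h2 h2
  · exact Jmat_comm _ _ _ _
  · omega
  · omega
  · rfl

lemma exists_lim_normalized (hS : OrdPart S) {w : ℕ → Fin d → ℝ} (hw : ∀ n i, 0 < w n i)
    {j : Fin r} {i : Fin d} (hi : i ∈ S j) {c : Fin d → ℝ} (hc : ∀ i ∈ S j, 0 < c i)
    (hL : ∀ i' ∈ S j, ∃ L : ℝ, 0 < L ∧ Tendsto (fun n => w n i' / w n i) atTop (𝓝 L)) :
    ∃ L : ℝ, 0 < L ∧
      Tendsto (fun n => c i * w n i / ∑ i' ∈ S j, c i' * w n i') atTop (𝓝 L) := by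
  choose! L hLpos hL using hL
  have hsum : 0 < ∑ i' ∈ S j, c i' * L i' :=
    Finset.sum_pos (fun i' h => mul_pos (hc i' h) (hLpos i' h)) (hS.1 j)
  refine ⟨c i / ∑ i' ∈ S j, c i' * L i', div_pos (hc i hi) hsum, ?_⟩
  have ht : Tendsto (fun n => ∑ i' ∈ S j, c i' * (w n i' / w n i)) atTop
      (𝓝 (∑ i' ∈ S j, c i' * L i')) :=
    tendsto_finsetSum _ fun i' h => (hL i' h).const_mul (c i')
  refine ((tendsto_const_nhds (x := c i)).div ht hsum.ne').congr fun n => ?_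
  have hwi := (hw n i).ne'
  simp only [Pi.div_apply, ← mul_div_assoc, ← Finset.sum_div]
  rw [div_div_eq_mul_div]

variable {Q : Fin r → Finset (Fin d)}

lemma not_mem_lower (hS : OrdPart S) (hQ : ∀ j, Q j = (Finset.univ.filter (· < j)).biUnion S)
    {j : Fin r} {i : Fin d} (hi : i ∈ S j) : i ∉ Q j := by
  rw [hQ]
  simp only [Finset.mem_biUnion, Finset.mem_filter, Finset.mem_univ, true_and, not_exists, not_and]
  exact fun a ha h => Finset.disjoint_left.1 (hS.2.1 a j ha.ne) h hi

/-- The renormalized weights on a cell of the limiting partition are a scale for that cell. -/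
lemma LimPart.blockScale {lam : Fin d → ℝ} (hlam : Function.Injective lam) {w : ℕ → Fin d → ℝ}
    (hw : ∀ n i, 0 < w n i) (hS : LimPart w S)
    (hQ : ∀ j, Q j = (Finset.univ.filter (· < j)).biUnion S) (j : Fin r) {v : Fin d → ℝ}
    (hpos : ∀ i ∈ S j, 0 < v i)
    (hv : ∀ i ∈ S j, Tendsto (fun n => Cc lam i (Q j) * w n i /
      ∑ i' ∈ S j, Cc lam i' (Q j) * w n i') atTop (𝓝 (v i))) :
    BlockScale lam w (Q j) (S j) (fun n => ∑ i' ∈ S j, Cc lam i' (Q j) * w n i') v where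
  inj := hlam
  disj := Finset.disjoint_right.2 fun _ hi => not_mem_lower hS.1 hQ hi
  weight_pos := hw
  scale_pos n := Finset.sum_pos
    (fun i hi => mul_pos (Cc_pos hlam (not_mem_lower hS.1 hQ hi)) (hw n i)) (hS.1.1 j)
  lim_pos := hpos
  before i hi := by
    rw [hQ] at hi
    simp only [Finset.mem_biUnion, Finset.mem_filter, Finset.mem_univ, true_and] at hi
    obtain ⟨a, ha, hia⟩ := hi
    have : Tendsto (fun n => ∑ i' ∈ S j, Cc lam i' (Q j) * (w n i / w n i')⁻¹) atTop
        (𝓝 (∑ i' ∈ S j, Cc lam i' (Q j) * 0)) :=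
      tendsto_finsetSum _ fun i' hi' =>
        ((hS.2.2 a j ha i hia i' hi').inv_tendsto_atTop).const_mul _
    simp only [mul_zero, Finset.sum_const_zero] at this
    refine this.congr fun n => ?_
    rw [Finset.sum_div]
    exact Finset.sum_congr rfl fun i' _ => by rw [inv_div, mul_div_assoc]
  within := hv
  after i hiA hiB := by
    obtain ⟨b, hib⟩ : ∃ b, i ∈ S b := by
      have := Finset.mem_univ i
      rw [← hS.1.2.2] at this
      simpa using this
    have hjb : j < b := by
      rcases lt_trichotomy j b with h | rfl | h
      · exact h
      · exact absurd hib hiB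
      · refine absurd ?_ hiA
        rw [hQ]
        exact Finset.mem_biUnion.2 ⟨b, by simpa using h, hib⟩
    obtain ⟨k, hk⟩ := hS.1.1 j
    have hC := (Cc_pos hlam (not_mem_lower hS.1 hQ hk)).ne'
    have := ((hS.2.2 j b hjb k hk i hib).inv_tendsto_atTop).mul
      ((hv k hk).div_const (Cc lam k (Q j)))
    rw [zero_mul] at this
    refine this.congr fun n => ?_
    have := (hw n k).ne'
    simp only [Pi.inv_apply]
    field_simp

lemma LimPart.blockStart {lam : Fin d → ℝ} {w : ℕ → Fin d → ℝ} (hS : LimPart w S)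
    (hQ : ∀ j, Q j = (Finset.univ.filter (· < j)).biUnion S) {v : Fin r → Fin d → ℝ}
    (hscale : ∀ j, BlockScale lam w (Q j) (S j)
      (fun n => ∑ i' ∈ S j, Cc lam i' (Q j) * w n i') (v j)) (j : Fin r) :
    BlockStart lam w (Q j) (fun n => ∑ i' ∈ S j, Cc lam i' (Q j) * w n i') := by
  obtain ⟨j, hj⟩ := j
  induction j with
  | zero =>
    have h0 : Q ⟨0, hj⟩ = ∅ := by
      rw [hQ, Finset.filter_false_of_mem fun i _ => by simp [Fin.lt_def], Finset.biUnion_empty]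
    rw [h0]
    exact blockStart_empty _ _ _
  | succ j ih =>
    have hj' : j < r := by omega
    have hlt : (⟨j, hj'⟩ : Fin r) < ⟨j + 1, hj⟩ := Nat.lt_succ_self j
    have hQS : Q ⟨j + 1, hj⟩ = Q ⟨j, hj'⟩ ∪ S ⟨j, hj'⟩ := by
      have hins : Finset.univ.filter (· < (⟨j + 1, hj⟩ : Fin r)) =
          insert ⟨j, hj'⟩ (Finset.univ.filter (· < (⟨j, hj'⟩ : Fin r))) := by
        ext i
        simp only [Finset.mem_filter, Finset.mem_univ, true_and, Finset.mem_insert, Fin.ext_iff,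
          Fin.lt_def]
        omega
      rw [hQ, hQ, hins, Finset.biUnion_insert, Finset.union_comm]
    have hnext := (hscale ⟨j, hj'⟩).blockStart_next (ih hj') (hS.1.1 _)
      (W' := fun n => ∑ i' ∈ S ⟨j + 1, hj⟩, Cc lam i' (Q ⟨j + 1, hj⟩) * w n i') (by
        have : Tendsto (fun n => ∑ i ∈ S ⟨j + 1, hj⟩, Cc lam i (Q ⟨j + 1, hj⟩) *
            (w n i / ∑ i' ∈ S ⟨j, hj'⟩, Cc lam i' (Q ⟨j, hj'⟩) * w n i')) atTop
            (𝓝 (∑ i ∈ S ⟨j + 1, hj⟩, Cc lam i (Q ⟨j + 1, hj⟩) * 0)) :=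
          tendsto_finsetSum _ fun i hi => by
            have hn := not_mem_lower hS.1 hQ hi
            rw [hQS, Finset.mem_union, not_or] at hn
            exact ((hscale ⟨j, hj'⟩).after i hn.1 hn.2).const_mul _
        simp only [mul_zero, Finset.sum_const_zero, ← mul_div_assoc, ← Finset.sum_div] at this
        exact this)
    rw [← hQS] at hnext
    exact hnext

/-- Convergence of the upper triangular part to the block-diagonal matrix. -/
lemma tendsto_Jmat_of_le {lam : Fin d → ℝ} {w : ℕ → Fin d → ℝ} (hS : OrdPart S)
    (hQ : ∀ j, Q j = (Finset.univ.filter (· < j)).biUnion S) {W : Fin r → ℕ → ℝ}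
    {v : Fin r → Fin d → ℝ} (hscale : ∀ j, BlockScale lam w (Q j) (S j) (W j) (v j))
    (hstart : ∀ j, BlockStart lam w (Q j) (W j)) {p q : Fin d} (hpq : p ≤ q) :
    Tendsto (fun n => Jmat lam (w n) p q) atTop (𝓝 (blockDiag lam S v p q)) := by
  have hoff : ∀ j, offS S j = (Q j).card := fun j => by rw [hQ, offS_eq_card hS]
  obtain ⟨j, hp⟩ := exists_block hS p
  obtain ⟨l, hl⟩ := Nat.exists_eq_add_of_le hp.1
  have hlS : l < (S j).card := by omega
  rw [blockDiag_apply lam v hp]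
  rcases (show (q : ℕ) = p ∨ (q : ℕ) = p + 1 ∨ (p : ℕ) + 1 < q by
    have : (p : ℕ) ≤ q := hpq
    omega) with h | h | h
  · obtain rfl : q = p := Fin.ext h
    rw [dif_pos hp, Jmat_diag]
    simp only [Jmat_diag, hl, Nat.add_sub_cancel_left, hoff]
    exact (hscale j).tendsto_fEnt_odd (hstart j) hlS
  · simp only [Jmat_succ _ _ h]
    by_cases hq : offS S j ≤ (q : ℕ) ∧ (q : ℕ) < offS S j + (S j).card
    · rw [dif_pos hq, Jmat_succ _ _ (by simp only; omega)]
      simp only [hl, Nat.add_sub_cancel_left, hoff]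
      exact (hscale j).tendsto_fEnt_even (hstart j) (by omega)
    · rw [dif_neg hq]
      obtain ⟨k, hk⟩ := exists_block hS q
      have hjk : j < k := by
        rcases lt_trichotomy j k with h' | rfl | h'
        · exact h'
        · exact absurd hk hq
        · have := offS_add_card_le S h'
          omega
      have := offS_add_card_le S hjk
      exact (hscale k).tendsto_fEnt_start (hstart k) (by rw [← hoff]; omega)
  · simp only [Jmat_far _ _ h]
    split_ifs with hq
    · rw [Jmat_far _ _ (by simp only; omega)]
      exact tendsto_const_nhds
    · exact tendsto_const_nhds

end Partition

/-- entrywise convergence of `f(λ, w(n))` for a stable sequence, with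
block-diagonal limit built from the limits of the renormalized weight vectors. -/
theorem stmt0 {d r : ℕ} (hd : 1 ≤ d) (lam : Fin d → ℝ) (hlam : Function.Injective lam)
    (w : ℕ → Fin d → ℝ) (hstab : Stable w)
    (S : Fin r → Finset (Fin d)) (hS : LimPart w S)
    (Q : Fin r → Finset (Fin d))
    (hQ : ∀ j, Q j = (Finset.univ.filter (· < j)).biUnion S)
    (vseq : ℕ → Fin r → Fin d → ℝ)
    (hv : ∀ n j i, vseq n j i =
      if i ∈ S j then Cc lam i (Q j) * w n i / ∑ i' ∈ S j, Cc lam i' (Q j) * w n i' else 0) :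
    ∃ vlim : Fin r → Fin d → ℝ,
      (∀ j, ∀ i ∈ S j, 0 < vlim j i) ∧
      (∀ j i, Tendsto (fun n => vseq n j i) atTop (𝓝 (vlim j i))) ∧
      ∀ p q : Fin d,
        Tendsto (fun n => Jmat lam (w n) p q) atTop (𝓝 (blockDiag lam S vlim p q)) := by
  have hC : ∀ j, ∀ i ∈ S j, 0 < Cc lam i (Q j) := fun j i hi =>
    Cc_pos hlam (not_mem_lower hS.1 hQ hi)
  have hlim : ∀ j i, ∃ c, (i ∈ S j → 0 < c) ∧
      Tendsto (fun n => vseq n j i) atTop (𝓝 c) := fun j i => by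
    simp only [hv]
    by_cases hi : i ∈ S j
    · simp only [if_pos hi]
      obtain ⟨c, hc, hlim⟩ := exists_lim_normalized hS.1 hstab.1 hi (hC j)
        fun i' hi' => (hS.2.1 i' i).1 ⟨j, hi', hi⟩
      exact ⟨c, fun _ => hc, hlim⟩
    · simp only [if_neg hi]
      exact ⟨0, fun h => absurd h hi, tendsto_const_nhds⟩
  choose vlim hpos hlim using hlim
  have hscale := fun j => hS.blockScale hlam hstab.1 hQ j (hpos j) fun i hi => by
    simpa only [hv, if_pos hi] using hlim j i
  have hstart := hS.blockStart hQ hscale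
  refine ⟨vlim, hpos, hlim, fun p q => ?_⟩
  rcases le_total p q with h | h
  · exact tendsto_Jmat_of_le hS.1 hQ hscale hstart h
  · simp only [fun n => Jmat_comm lam (w n) p q, blockDiag_comm lam vlim p q]
    exact tendsto_Jmat_of_le hS.1 hQ hscale hstart h
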